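/- Corollary (characterization): The pair (g, p) satisfies IC if and only if it satisfies MFF. -/

import Mathlib

/-- Incentive compatibility (IC) of a diffusion auction, for a single agent
with the other agents' reports held fixed. -/
def IC {α : Type*} (g p : ℝ → Finset α → ℝ) : Prop :=
  ∀ r r' : Finset α, r' ⊆ r → ∀ v v' : ℝ,
    v * g v r - p v r ≥ v * g v' r' - p v' r'

/-- Diffusion dominant strategy incentive compatibility (DDSIC). -/
def DDSIC {α : Type*} (g p : ℝ → Finset α → ℝ) : Prop :=
  (∀ r' : Finset α, ∀ v v' : ℝ,
    v * g v r' - p v r' ≥ v * g v' r' - p v' r') ∧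
  (∀ r r' : Finset α, r' ⊆ r → ∀ v : ℝ,
    v * g v r - p v r ≥ v * g v r' - p v r')

/-- Monotonicity and forwarding-friendliness (MFF). -/
def MFF {α : Type*} (g p : ℝ → Finset α → ℝ) : Prop :=
  (∀ r' : Finset α, Monotone (fun v => g v r')) ∧
  (∀ r' : Finset α, ∀ v : ℝ,
    p v r' = p 0 r' + v * g v r' - ∫ y in (0:ℝ)..v, g y r') ∧
  (∀ r r' : Finset α, r' ⊆ r → ∀ v : ℝ,
    p 0 r' - p 0 r ≥ ∫ y in (0:ℝ)..v, (g y r' - g y r))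

/-- The subgradient inequality for the primitive of a monotone function, valid for either order of
the endpoints. -/
theorem Monotone.sub_mul_le_intervalIntegral {f : ℝ → ℝ} (hf : Monotone f) (a b : ℝ) :
    (b - a) * f a ≤ ∫ y in a..b, f y := by
  rcases le_total a b with hab | hba
  · have h := intervalIntegral.integral_mono_on hab
      (intervalIntegrable_const (μ := MeasureTheory.volume) (c := f a)) hf.intervalIntegrable
      fun x hx => hf hx.1
    simpa using h
  · have h := intervalIntegral.integral_mono_on hba
      hf.intervalIntegrable (intervalIntegrable_const (μ := MeasureTheory.volume) (c := f a))
      fun x hx => hf hx.2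
    rw [intervalIntegral.integral_const, smul_eq_mul] at h
    rw [intervalIntegral.integral_symm]
    linarith

/-- A function whose increments are bounded by products of increments of the identity and of another
function is constant. -/
theorem eq_of_forall_abs_sub_le_mul_sub {f h : ℝ → ℝ}
    (H : ∀ a b, a ≤ b → |h b - h a| ≤ (b - a) * (f b - f a)) {a b : ℝ} (hab : a ≤ b) :
    h b = h a := by
  have key : ∀ n : ℕ, ∀ a b, a ≤ b → |h b - h a| ≤ (1 / 2) ^ n * ((b - a) * (f b - f a)) := by
    intro n
    induction n with
    | zero => simpa using H
    | succ n ih =>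
      intro a b hab
      have h₁ := ih a ((a + b) / 2) (by linarith)
      have h₂ := ih ((a + b) / 2) b (by linarith)
      have h₃ := abs_sub_le (h b) (h ((a + b) / 2)) (h a)
      rw [pow_succ]
      linarith
  have hlim : Filter.Tendsto (fun n : ℕ => (1 / 2 : ℝ) ^ n * ((b - a) * (f b - f a)))
      Filter.atTop (nhds 0) := by
    simpa using (tendsto_pow_atTop_nhds_zero_of_lt_one (r := (1 / 2 : ℝ)) (by norm_num)
      (by norm_num)).mul_const ((b - a) * (f b - f a))
  exact sub_eq_zero.mp (abs_nonpos_iff.mp (ge_of_tendsto' hlim fun n => key n a b hab))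

/-- A function having `f` as a subgradient at every point forces `f` to be monotone. -/
theorem monotone_of_forall_sub_mul_le {f u : ℝ → ℝ}
    (hu : ∀ a b, (b - a) * f a ≤ u b - u a) : Monotone f := by
  intro a b hab
  rcases hab.eq_or_lt with rfl | hlt
  · exact le_rfl
  · nlinarith [hu a b, hu b a]

/-- A function having `f` as a subgradient at every point is a primitive of `f`. -/
theorem intervalIntegral_eq_sub_of_forall_sub_mul_le {f u : ℝ → ℝ}
    (hu : ∀ a b, (b - a) * f a ≤ u b - u a) (a b : ℝ) :
    ∫ y in a..b, f y = u b - u a := by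
  have hf := monotone_of_forall_sub_mul_le hu
  have H : ∀ c d, c ≤ d → |(u d - ∫ y in a..d, f y) - (u c - ∫ y in a..c, f y)| ≤
      (d - c) * (f d - f c) := by
    intro c d _
    have h₁ := intervalIntegral.integral_add_adjacent_intervals
      (hf.intervalIntegrable (μ := MeasureTheory.volume) (a := a) (b := c))
      (hf.intervalIntegrable (b := d))
    have h₂ := hf.sub_mul_le_intervalIntegral c d
    have h₃ := hf.sub_mul_le_intervalIntegral d c
    rw [intervalIntegral.integral_symm] at h₃
    rw [abs_le]
    constructor <;> linarith [hu c d, hu d c]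
  have h : (u b - ∫ y in a..b, f y) = u a - ∫ y in a..a, f y := by
    rcases le_total a b with hab | hba
    · exact eq_of_forall_abs_sub_le_mul_sub H hab
    · exact (eq_of_forall_abs_sub_le_mul_sub H hba).symm
  rw [intervalIntegral.integral_same] at h
  linarith

/-- Characterization: IC holds if and only if MFF holds. -/
theorem ic_iff_mff {α : Type*} (g p : ℝ → Finset α → ℝ) :
    IC g p ↔ MFF g p := by
  constructor
  · intro hIC
    have hu : ∀ r a b, (b - a) * g a r ≤ (b * g b r - p b r) - (a * g a r - p a r) := by
      intro r a b
      linarith [hIC r r subset_rfl b a]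
    have hmono : ∀ r, Monotone fun v => g v r := fun r =>
      monotone_of_forall_sub_mul_le (u := fun v => v * g v r - p v r) (hu r)
    have hint : ∀ r v, ∫ y in (0 : ℝ)..v, g y r = v * g v r - p v r + p 0 r := by
      intro r v
      have h := intervalIntegral_eq_sub_of_forall_sub_mul_le
        (f := fun v => g v r) (u := fun v => v * g v r - p v r) (hu r) 0 v
      linarith
    refine ⟨hmono, fun r v => by linarith [hint r v], fun r r' hr v => ?_⟩
    rw [intervalIntegral.integral_sub (hmono r').intervalIntegrable (hmono r).intervalIntegrable,
      hint, hint]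
    linarith [hIC r r' hr v v]
  · rintro ⟨hmono, hpay, hfwd⟩ r r' hr v v'
    have h₁ := hfwd r r' hr v
    rw [intervalIntegral.integral_sub (hmono r').intervalIntegrable
      (hmono r).intervalIntegrable] at h₁
    have h₂ := (hmono r').sub_mul_le_intervalIntegral v' v
    have h₃ := intervalIntegral.integral_add_adjacent_intervals
      ((hmono r').intervalIntegrable (μ := MeasureTheory.volume) (a := 0) (b := v'))
      ((hmono r').intervalIntegrable (b := v))
    linarith [hpay r v, hpay r' v']
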